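/- Let B be an affine UFD over k admitting a nontrivial fundamental pair (D,U) such that, setting A = ker D and A_0 = A ∩ ker U, one has A_0 ≠ k and A ≅ k^[2]. Then either (1) B ≅ k[X,Y,Z] ≅ k^[3] with (D,U) corresponding to (Y∂_Z, Z∂_Y), or (2) B ≅ k[X,Y,Z,W]/(2XZ − Y² − P(W)) for some P(T) ∈ k[T], with (D,U) corresponding to the pair induced by (X∂_Y + Y∂_Z, 2Y∂_X + 2Z∂_Y) on k[X,Y,Z,W]. In both cases the Makar-Limanov invariant ML(B), i.e., the intersection of the kernels of all locally nilpotent k-derivations of B, equals k. -/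

import Mathlib

/-- A derivation is locally nilpotent if every element is annihilated by some power. -/
def IsLND {R B : Type*} [CommRing R] [CommRing B] [Algebra R B]
    (D : Derivation R B B) : Prop :=
  ∀ b : B, ∃ n : ℕ, (D.toLinearMap ^ n) b = 0

/-- The degree-`d` piece `B_d = ker([D,U] - d·id)` of the `ℤ`-grading induced by `(D, U)`. -/
def gradePiece {R B : Type*} [CommRing R] [CommRing B] [Algebra R B]
    (D U : Derivation R B B) (d : ℤ) : Submodule R B :=
  LinearMap.ker ((⁅D, U⁆ : Derivation R B B).toLinearMap
    - d • (LinearMap.id : B →ₗ[R] B))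

/-- `(D, U)` is a fundamental pair: both are locally nilpotent, `[D,[D,U]] = -2D`,
`[U,[D,U]] = 2U`, and `B` is the sum of the eigenspaces of `[D,U]`. -/
def IsFundamentalPair {R B : Type*} [CommRing R] [CommRing B] [Algebra R B]
    (D U : Derivation R B B) : Prop :=
  IsLND D ∧ IsLND U ∧
    ⁅D, ⁅D, U⁆⁆ = (-2 : ℤ) • D ∧
    ⁅U, ⁅D, U⁆⁆ = (2 : ℤ) • U ∧
    (⨆ d : ℤ, gradePiece D U d) = ⊤

/-- The kernel of a derivation, as a subalgebra. -/
def kerSubalg {R B : Type*} [CommRing R] [CommRing B] [Algebra R B]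
    (D : Derivation R B B) : Subalgebra R B where
  carrier := {b : B | D b = 0}
  mul_mem' := fun {a b} ha hb => by
    simp only [Set.mem_setOf_eq] at *
    rw [D.leibniz, ha, hb, smul_zero, smul_zero, add_zero]
  one_mem' := by simp [Set.mem_setOf_eq]
  add_mem' := fun {a b} ha hb => by
    simp only [Set.mem_setOf_eq] at *
    rw [map_add, ha, hb, add_zero]
  zero_mem' := by simp [Set.mem_setOf_eq]
  algebraMap_mem' := fun r => by simp [Set.mem_setOf_eq]

open MvPolynomial

set_option synthInstance.maxHeartbeats 1000000
set_option maxHeartbeats 1000000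

/-- The ideal `(2XZ − Y² − P(W))` of `k[X,Y,Z,W]` (variables `0=X, 1=Y, 2=Z, 3=W`). -/
noncomputable abbrev qIdeal (k : Type*) [Field k] (P : Polynomial k) :
    Ideal (MvPolynomial (Fin 4) k) :=
  Ideal.span {2 * X 0 * X 2 - X 1 ^ 2 - Polynomial.aeval (X 3) P}

section PlanePolynomial

variable {k : Type*} [Field k]

/-- In the plane, a prime ideal strictly containing a principal prime is maximal. -/
theorem MvPolynomial.isMaximal_of_span_singleton_lt {q : MvPolynomial (Fin 2) k} (hq : q ≠ 0)
    [(Ideal.span {q}).IsPrime] {J : Ideal (MvPolynomial (Fin 2) k)} [hJ : J.IsPrime]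
    (h : Ideal.span {q} < J) : J.IsMaximal := by
  have hdim := ringKrullDim_quotient_succ_le_of_nonZeroDivisor
    (mem_nonZeroDivisors_of_ne_zero hq)
  rw [MvPolynomial.ringKrullDim_of_isNoetherianRing, ringKrullDim_eq_zero_of_field] at hdim
  have h1 : ringKrullDim (MvPolynomial (Fin 2) k ⧸ Ideal.span {q}) ≤ 1 := by
    have h2 : ringKrullDim (MvPolynomial (Fin 2) k ⧸ Ideal.span {q}) + 1 ≤ 1 + 1 := by
      refine hdim.trans ?_
      simp
      rfl
    exact ENat.WithBot.add_le_add_one_right_iff.mp h2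
  have : Ring.KrullDimLE 1 (MvPolynomial (Fin 2) k ⧸ Ideal.span {q}) :=
    (Order.krullDimLE_iff _ _).2 (by exact_mod_cast h1)
  have hsurj := Ideal.Quotient.mk_surjective (I := Ideal.span {q})
  have hker : RingHom.ker (Ideal.Quotient.mk (Ideal.span {q})) ≤ J := by
    rw [Ideal.mk_ker]; exact h.le
  have hp : (J.map (Ideal.Quotient.mk (Ideal.span {q}))).IsPrime :=
    Ideal.map_isPrime_of_surjective hsurj hker
  have hcomap : (J.map (Ideal.Quotient.mk (Ideal.span {q}))).comap
      (Ideal.Quotient.mk (Ideal.span {q})) = J := by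
    rw [Ideal.comap_map_of_surjective' _ hsurj, sup_eq_left]
    exact hker
  have hne : J.map (Ideal.Quotient.mk (Ideal.span {q})) ≠ ⊥ := by
    intro h0
    rw [h0, ← RingHom.ker_eq_comap_bot, Ideal.mk_ker] at hcomap
    exact h.ne hcomap
  have := hp.isMaximal_of_ne_bot hne
  rw [← hcomap]
  exact Ideal.comap_isMaximal_of_surjective _ hsurj

/-- A factor of a nonzero monomial over a domain is a monomial. -/
theorem Polynomial.exists_eq_monomial_of_mul_eq_monomial {R : Type*} [CommRing R] [IsDomain R]
    {p q : Polynomial R} {n : ℕ} {c : R} (hc : c ≠ 0) (h : p * q = Polynomial.monomial n c) :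
    ∃ m ≤ n, ∃ a, p = Polynomial.monomial m a := by
  have hpq : p * q ≠ 0 := by rw [h]; simpa using hc
  have hp : p ≠ 0 := left_ne_zero_of_mul hpq
  have hq : q ≠ 0 := right_ne_zero_of_mul hpq
  have h1 : p.natDegree + q.natDegree = n := by
    rw [← Polynomial.natDegree_mul hp hq, h, Polynomial.natDegree_monomial_eq _ hc]
  have h2 : p.natTrailingDegree + q.natTrailingDegree = n := by
    rw [← Polynomial.natTrailingDegree_mul hp hq, h, Polynomial.natTrailingDegree_monomial hc]
  have h3 := p.natTrailingDegree_le_natDegree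
  have h4 := q.natTrailingDegree_le_natDegree
  refine ⟨p.natDegree, by omega, p.coeff p.natDegree, ?_⟩
  ext i
  rw [Polynomial.coeff_monomial]
  split_ifs with hi
  · rw [hi]
  · rcases lt_or_gt_of_ne hi with hi | hi
    · exact Polynomial.coeff_eq_zero_of_natDegree_lt hi
    · exact Polynomial.coeff_eq_zero_of_lt_natTrailingDegree (by omega)

/-- A nontrivial nonnegative grading of the plane, given by its coaction `φ`, with a nonconstant
degree-zero element admits homogeneous coordinates of degrees `0` and `n > 0`. -/
theorem MvPolynomial.exists_homogeneous_coordinates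
    (φ : MvPolynomial (Fin 2) k →ₐ[k] Polynomial (MvPolynomial (Fin 2) k))
    (hcoeff : ∀ a i, φ ((φ a).coeff i) = Polynomial.monomial i ((φ a).coeff i))
    (heval : ∀ a, (φ a).eval 1 = a)
    (h0 : ∃ a, φ a = Polynomial.C a ∧ a ∉ Set.range (C : k → MvPolynomial (Fin 2) k))
    (h1 : ∃ a, φ a ≠ Polynomial.C a) :
    ∃ w f : MvPolynomial (Fin 2) k, ∃ n : ℕ, 0 < n ∧ φ w = Polynomial.C w ∧
      φ f = Polynomial.monomial n f ∧ Prime f ∧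
      Function.Surjective (aeval ![w, f] : MvPolynomial (Fin 2) k →ₐ[k] _) := by
  classical
  have hmon : ∀ {a : MvPolynomial (Fin 2) k} {n c}, φ a = Polynomial.monomial n c → c = a := by
    intro a n c h
    have := heval a
    rw [h] at this
    simpa using this
  have hφinj : Function.Injective φ := fun a b h => by rw [← heval a, ← heval b, h]
  have hφ0 : ∀ {a}, a ≠ 0 → φ a ≠ 0 := fun h h' => h (hφinj (by rw [h', map_zero]))
  have hfac : ∀ {a b : MvPolynomial (Fin 2) k} {n}, a * b ≠ 0 →
      φ (a * b) = Polynomial.monomial n (a * b) →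
      ∃ m ≤ n, φ a = Polynomial.monomial m a := by
    intro a b n hab h
    rw [map_mul] at h
    obtain ⟨m, hm, c, hc⟩ := Polynomial.exists_eq_monomial_of_mul_eq_monomial hab h
    exact ⟨m, hm, by rw [hc, hmon hc]⟩
  have hfac0 : ∀ {a b : MvPolynomial (Fin 2) k}, a * b ≠ 0 →
      φ (a * b) = Polynomial.C (a * b) → φ a = Polynomial.C a := by
    intro a b hab h
    obtain ⟨m, hm, h'⟩ := hfac (n := 0) hab (by simpa using h)
    obtain rfl : m = 0 := by omega
    simpa using h'
  let π : MvPolynomial (Fin 2) k →+* MvPolynomial (Fin 2) k :=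
    Polynomial.constantCoeff.comp φ.toRingHom
  have hπ : ∀ a, π a = (φ a).coeff 0 := fun a => rfl
  have hπfix : ∀ {a}, φ a = Polynomial.C a → π a = a := fun {a} h => by rw [hπ, h]; simp
  have hπmem : ∀ a, φ (π a) = Polynomial.C (π a) := fun a => by rw [hπ, hcoeff]; simp
  have hππ : ∀ a, π (a - π a) = 0 := fun a => by
    rw [map_sub, hπfix (hπmem a), sub_self]
  set P := RingHom.ker π with hP
  have hPp : P.IsPrime := RingHom.ker_isPrime π
  obtain ⟨q, hq, hqP, n, hn, hqn⟩ : ∃ q, Prime q ∧ q ∈ P ∧ ∃ n, 0 < n ∧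
      φ q = Polynomial.monomial n q := by
    obtain ⟨a, ha⟩ := h1
    obtain ⟨i, hi, hi0⟩ : ∃ i, i ≠ 0 ∧ (φ a).coeff i ≠ 0 := by
      by_contra! hcon
      apply ha
      have h2 : φ a = Polynomial.C ((φ a).coeff 0) := by
        ext i : 1
        by_cases hi : i = 0
        · simp [hi]
        · rw [hcon i hi, Polynomial.coeff_C_of_ne_zero hi]
      have h3 : (φ a).coeff 0 = a := hmon (n := 0) (by simpa using h2)
      rwa [h3] at h2
    set g := (φ a).coeff i with hg
    have hgφ := hcoeff a i
    have hgP : g ∈ P := by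
      rw [hP, RingHom.mem_ker, hπ, hgφ, Polynomial.coeff_monomial, if_neg hi]
    obtain ⟨s, hs, u, hsu⟩ := UniqueFactorizationMonoid.exists_prime_factors g hi0
    have hsP : s.prod ∈ P := by
      have : s.prod * u * ↑u⁻¹ ∈ P := P.mul_mem_right _ (hsu ▸ hgP)
      simpa using this
    obtain ⟨q, hqs, hqP⟩ := (hPp.multiset_prod_mem_iff_exists_mem s).1 hsP
    obtain ⟨r, hr⟩ : q ∣ g := (Multiset.dvd_prod hqs).trans ⟨u, hsu.symm⟩
    obtain ⟨n, -, hn⟩ := hfac (a := q) (b := r) (n := i) (hr ▸ hi0) (hr ▸ hgφ)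
    refine ⟨q, hs q hqs, hqP, n, Nat.pos_of_ne_zero ?_, hn⟩
    rintro rfl
    apply (hs q hqs).ne_zero
    rw [← hπfix (a := q) (by simpa using hn)]
    exact hqP
  have hqprime : (Ideal.span {q}).IsPrime := (Ideal.span_singleton_prime hq.ne_zero).2 hq
  have hqle : Ideal.span {q} ≤ P := (Ideal.span_singleton_le_iff_mem _).2 hqP
  obtain ⟨w₀, hw₀, hw₀k⟩ := h0
  have hPq : Ideal.span {q} = P := by
    by_contra hne
    have hmax := isMaximal_of_span_singleton_lt hq.ne_zero (lt_of_le_of_ne hqle hne)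
    have hw₀0 : w₀ ≠ 0 := fun h => hw₀k ⟨0, by simp [h]⟩
    have hw₀P : w₀ ∉ P := fun h => hw₀0 (by rw [← hπfix hw₀]; exact h)
    obtain ⟨b, hb⟩ := hmax.exists_inv hw₀P
    obtain ⟨i, hi, hbi⟩ := hb
    have hu : π b * w₀ = 1 := by
      have := congrArg π hbi
      rwa [map_add, map_mul, map_one, hπfix hw₀, show π i = 0 from hi, add_zero] at this
    obtain ⟨r, -, hr⟩ := isUnit_iff_eq_C_of_isReduced.1 (IsUnit.of_mul_eq_one_right _ hu)
    exact hw₀k ⟨r, hr.symm⟩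
  have hdiv : ∀ {a}, π a = 0 → ∃ c, a = q * c := fun {a} h => by
    have : a ∈ Ideal.span {q} := by rw [hPq]; exact h
    exact Ideal.mem_span_singleton.1 this
  let M := RingHom.ker ((constantCoeff : MvPolynomial (Fin 2) k →+* k).comp π)
  have hMp : M.IsPrime := RingHom.ker_isPrime _
  have hMmem : ∀ {a}, a ∈ M ↔ constantCoeff (π a) = 0 := fun {a} => Iff.rfl
  have hCφ : ∀ r : k, φ (C r) = Polynomial.C (C r) := fun r => by
    simp [← algebraMap_eq, Polynomial.algebraMap_apply]
  obtain ⟨p, hp, hpM, hpφ⟩ : ∃ p, Prime p ∧ p ∈ M ∧ φ p = Polynomial.C p := by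
    set g := w₀ - C (constantCoeff w₀) with hg
    have hg0 : g ≠ 0 := fun h => hw₀k ⟨_, (sub_eq_zero.1 h).symm⟩
    have hgφ : φ g = Polynomial.C g := by rw [hg, map_sub, hw₀, hCφ, map_sub]
    have hgM : g ∈ M := by rw [hMmem, hπfix hgφ]; simp [hg]
    obtain ⟨s, hs, u, hsu⟩ := UniqueFactorizationMonoid.exists_prime_factors g hg0
    have hsM : s.prod ∈ M := by
      have : s.prod * u * ↑u⁻¹ ∈ M := M.mul_mem_right _ (hsu ▸ hgM)
      simpa using this
    obtain ⟨p, hps, hpM⟩ := (hMp.multiset_prod_mem_iff_exists_mem s).1 hsM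
    obtain ⟨r, hr⟩ : p ∣ g := (Multiset.dvd_prod hps).trans ⟨u, hsu.symm⟩
    exact ⟨p, hs p hps, hpM, hfac0 (hr ▸ hg0) (hr ▸ hgφ)⟩
  let Q := (Ideal.span {p}).comap π
  have hQp : Q.IsPrime := by
    have : (Ideal.span {p}).IsPrime := (Ideal.span_singleton_prime hp.ne_zero).2 hp
    exact Ideal.comap_isPrime _ _
  have hQlt : Ideal.span {q} < Q := by
    refine lt_of_le_of_ne ?_ ?_
    · rw [hPq]
      intro a ha
      rw [Ideal.mem_comap, show π a = 0 from ha]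
      exact zero_mem _
    · intro h
      have : p ∈ Q := by
        rw [Ideal.mem_comap, hπfix hpφ]
        exact Ideal.mem_span_singleton_self p
      rw [← h, hPq] at this
      exact hp.ne_zero (by rw [← hπfix hpφ]; exact this)
  have hQmax := isMaximal_of_span_singleton_lt hq.ne_zero hQlt
  have hQM : Q = M := by
    refine hQmax.eq_of_le hMp.ne_top fun a ha => ?_
    obtain ⟨c, hc⟩ := Ideal.mem_span_singleton.1 (Ideal.mem_comap.1 ha)
    rw [hMmem, hc, map_mul]
    rw [hMmem, hπfix hpφ] at hpM
    rw [hpM, zero_mul]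
  have hpdiv : ∀ {a}, φ a = Polynomial.C a → constantCoeff a = 0 → ∃ c, a = p * c := by
    intro a ha h
    have : a ∈ Q := by rw [hQM, hMmem, hπfix ha, h]
    rw [Ideal.mem_comap, hπfix ha] at this
    exact Ideal.mem_span_singleton.1 this
  have hpdeg : 0 < p.totalDegree := by
    rw [Nat.pos_iff_ne_zero]
    intro h
    rw [totalDegree_eq_zero_iff_eq_C] at h
    rw [hMmem, hπfix hpφ] at hpM
    apply hp.ne_zero
    rw [h, ← constantCoeff_eq, hpM, C_0]
  let S := (aeval ![p, q] : MvPolynomial (Fin 2) k →ₐ[k] MvPolynomial (Fin 2) k).range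
  have hpS : p ∈ S := ⟨X 0, by simp⟩
  have hqS : q ∈ S := ⟨X 1, by simp⟩
  have hS0 : ∀ (N : ℕ) a, φ a = Polynomial.C a → a.totalDegree ≤ N → a ∈ S := by
    intro N
    induction N with
    | zero =>
      intro a _ h
      rw [totalDegree_eq_zero_iff_eq_C.1 (Nat.le_zero.1 h)]
      exact S.algebraMap_mem _
    | succ N ih =>
      intro a ha h
      have hφ' : φ (a - C (constantCoeff a)) = Polynomial.C (a - C (constantCoeff a)) := by
        rw [map_sub, ha, hCφ, map_sub]
      obtain ⟨c, hc⟩ := hpdiv hφ' (by simp)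
      have hac : a = p * c + C (constantCoeff a) := by rw [← hc]; ring
      have hCS : C (constantCoeff a) ∈ S := S.algebraMap_mem _
      by_cases hc0 : c = 0
      · rw [hac, hc0, mul_zero, zero_add]; exact hCS
      have hcφ : φ c = Polynomial.C c := by
        refine hfac0 (b := p) (mul_ne_zero hc0 hp.ne_zero) ?_
        rw [mul_comm, ← hc, hφ']
      rw [hac]
      refine S.add_mem (S.mul_mem hpS (ih c hcφ ?_)) hCS
      have h5 := totalDegree_mul_of_isDomain hp.ne_zero hc0
      have h6 := totalDegree_sub_C_le a (constantCoeff a)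
      rw [hc] at h6
      omega
  have hS : ∀ (N : ℕ) a, (φ a).natDegree ≤ N → a ∈ S := by
    intro N
    induction N using Nat.strong_induction_on with
    | _ N ih =>
      intro a h
      obtain ⟨c, hc⟩ := hdiv (hππ a)
      have hac : a = q * c + π a := by rw [← hc]; ring
      have hCS : π a ∈ S := hS0 _ _ (hπmem a) le_rfl
      by_cases hc0 : c = 0
      · rw [hac, hc0, mul_zero, zero_add]; exact hCS
      rw [hac]
      refine S.add_mem (S.mul_mem hqS ?_) hCS
      have h5 : (φ (a - π a)).natDegree ≤ (φ a).natDegree := by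
        rw [map_sub, hπmem, Polynomial.natDegree_sub_C]
      rw [hc, map_mul, Polynomial.natDegree_mul (hφ0 hq.ne_zero) (hφ0 hc0), hqn,
        Polynomial.natDegree_monomial_eq _ hq.ne_zero] at h5
      exact ih _ (by omega) c le_rfl
  exact ⟨p, q, n, hn, hpφ, hqn, hq, fun a => hS _ a le_rfl⟩

end PlanePolynomial

section Coaction

variable {k R : Type*} [Field k] [CharZero k] [CommRing R] [Algebra k R]

/-- A derivation whose eigenspaces with natural eigenvalues span is the Euler derivation of a
grading, encoded by its coaction. -/
theorem Derivation.exists_coaction (ε : Derivation k R R)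
    (h : ⨆ d : ℕ, Module.End.eigenspace ε.toLinearMap (d : k) = ⊤) :
    ∃ φ : R →ₐ[k] Polynomial R,
      (∀ a (d : ℕ), ε a = (d : k) • a → φ a = Polynomial.monomial d a) ∧
      (∀ a i, ε ((φ a).coeff i) = (i : k) • (φ a).coeff i) ∧
      (∀ a i, φ ((φ a).coeff i) = Polynomial.monomial i ((φ a).coeff i)) ∧
      (∀ a, (φ a).eval 1 = a) := by
  classical
  let 𝒜 : ℕ → Submodule k R := fun d => Module.End.eigenspace ε.toLinearMap (d : k)
  have hmem : ∀ {d a}, a ∈ 𝒜 d ↔ ε a = (d : k) • a := fun {d a} => Module.End.mem_eigenspace_iff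
  have hgm : SetLike.GradedMonoid 𝒜 :=
    { one_mem := by rw [hmem]; simp
      mul_mem := fun {i j a b} ha hb => by
        rw [hmem] at ha hb ⊢
        rw [Derivation.leibniz, ha, hb]
        simp only [smul_eq_mul, Algebra.smul_def]
        push_cast
        ring }
  have hinternal : DirectSum.IsInternal 𝒜 :=
    DirectSum.isInternal_submodule_of_iSupIndep_of_iSup_eq_top
      ((Module.End.eigenspaces_iSupIndep ε.toLinearMap).comp Nat.cast_injective) h
  let ψ := hinternal.coeAlgEquiv
  let Φ : (DirectSum ℕ fun i => 𝒜 i) →ₐ[k] Polynomial R :=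
    DirectSum.toAlgebra k (fun i => 𝒜 i)
      (fun i => ((Polynomial.monomial i).restrictScalars k).comp (𝒜 i).subtype)
      (by simp [GradedMonoid.GOne.one])
      (fun {i j} ai aj => by simp [GradedMonoid.GMul.mul, Polynomial.monomial_mul_monomial])
  let φ : R →ₐ[k] Polynomial R := Φ.comp ψ.symm.toAlgHom
  have hφ : ∀ a (d : ℕ), ε a = (d : k) • a → φ a = Polynomial.monomial d a := by
    intro a d had
    have : ψ.symm a = DirectSum.of (fun i => 𝒜 i) d ⟨a, hmem.2 had⟩ := by
      rw [AlgEquiv.symm_apply_eq]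
      exact (DirectSum.coeAlgHom_of 𝒜 d ⟨a, _⟩).symm
    change Φ (ψ.symm a) = _
    rw [this]
    exact DirectSum.toAddMonoid_of (β := fun i => 𝒜 i)
      (fun i => (((Polynomial.monomial i).restrictScalars k).comp (𝒜 i).subtype).toAddMonoidHom)
      d ⟨a, _⟩
  have hind : ∀ {p : R → Prop}, (∀ (d : ℕ) a, ε a = (d : k) • a → p a) → p 0 →
      (∀ a b, p a → p b → p (a + b)) → ∀ a, p a := by
    intro p h1 h2 h3 a
    have ha : a ∈ ⨆ d : ℕ, 𝒜 d := by rw [h]; trivial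
    exact Submodule.iSup_induction 𝒜 (motive := p) ha (fun d x hx => h1 d x (hmem.1 hx)) h2 h3
  have hcoeff : ∀ a i, ε ((φ a).coeff i) = (i : k) • (φ a).coeff i := by
    refine hind ?_ (by simp) ?_
    · intro d a ha i
      rw [hφ a d ha, Polynomial.coeff_monomial]
      split_ifs with hi
      · rw [ha, hi]
      · simp
    · intro a b ha hb i
      rw [map_add, Polynomial.coeff_add, map_add, ha, hb, smul_add]
  refine ⟨φ, hφ, hcoeff, fun a i => hφ _ _ (hcoeff a i), hind ?_ (by simp) ?_⟩
  · intro d a ha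
    rw [hφ a d ha]
    simp
  · intro a b ha hb
    rw [map_add, Polynomial.eval_add, ha, hb]

end Coaction

section Derivation

variable {k B : Type*} [Field k] [CommRing B] [Algebra k B]

/-- The leading term of the Leibniz formula for iterates on elements of bounded nilpotency. -/
theorem Derivation.iterate_add_mul (D : Derivation k B B) (m l : ℕ) {a b : B}
    (ha : D^[m + 1] a = 0) (hb : D^[l + 1] b = 0) :
    D^[m + l] (a * b) = ((m + l).choose m : B) * (D^[m] a * D^[l] b) := by
  induction hN : m + l generalizing m l a b with
  | zero =>
    obtain ⟨rfl, rfl⟩ : m = 0 ∧ l = 0 := by omega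
    simp
  | succ N ih =>
    have hadd : ∀ x y, D^[N] (x + y) = D^[N] x + D^[N] y := fun x y =>
      iterate_map_add (D : B →ₗ[k] B) N x y
    rw [Function.iterate_succ_apply, Derivation.leibniz, smul_eq_mul, smul_eq_mul, hadd]
    rcases m with - | m
    · obtain rfl : l = N + 1 := by omega
      have ha0 : D a = 0 := ha
      have := ih 0 N (a := a) (b := D b) ha (by simpa using hb) (by omega)
      have hz : D^[N] 0 = 0 := iterate_map_zero (D : B →ₗ[k] B) N
      rw [this, ha0, mul_zero, hz]
      simp
    · rcases l with - | l
      · obtain rfl : m = N := by omega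
        have hb0 : D b = 0 := hb
        have := ih m 0 (a := D a) (b := b) (by simpa using ha) hb (by omega)
        have hz : D^[m] 0 = 0 := iterate_map_zero (D : B →ₗ[k] B) m
        rw [mul_comm b, this, hb0, mul_zero, hz]
        simp
      · have h1 := ih (m + 1) l (a := a) (b := D b) ha (by simpa using hb) (by omega)
        have h2 := ih m (l + 1) (a := D a) (b := b) (by simpa using ha) hb (by omega)
        rw [mul_comm b, h1, h2, ← Function.iterate_succ_apply, ← Function.iterate_succ_apply,
          Nat.choose_succ_succ]
        push_cast
        ring

/-- Nilpotency degrees of a derivation are subadditive under products. -/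
theorem Derivation.iterate_mul_eq_zero (D : Derivation k B B) {m l : ℕ} {a b : B}
    (ha : D^[m + 1] a = 0) (hb : D^[l + 1] b = 0) : D^[m + l + 1] (a * b) = 0 := by
  rw [Function.iterate_succ_apply', D.iterate_add_mul m l ha hb, Derivation.leibniz,
    Derivation.leibniz, ← Function.iterate_succ_apply' (f := D),
    ← Function.iterate_succ_apply' (f := D), ha, hb]
  simp

theorem isLND_iff (D : Derivation k B B) : IsLND D ↔ ∀ b, ∃ n, D^[n] b = 0 := by
  simp only [IsLND, Module.End.pow_apply]
  rfl

theorem Derivation.iterate_eq_zero_of_le (D : Derivation k B B) {m n : ℕ} (h : m ≤ n) {b : B}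
    (hb : D^[m] b = 0) : D^[n] b = 0 := by
  obtain ⟨j, rfl⟩ := Nat.exists_eq_add_of_le' h
  rw [Function.iterate_add_apply, hb]
  exact iterate_map_zero (D : B →ₗ[k] B) j

/-- The elements annihilated by some power of a derivation. -/
def Derivation.nilSubalgebra (D : Derivation k B B) : Subalgebra k B where
  carrier := {b | ∃ n, D^[n + 1] b = 0}
  mul_mem' := by
    rintro a b ⟨m, hm⟩ ⟨l, hl⟩
    exact ⟨m + l, D.iterate_mul_eq_zero hm hl⟩
  add_mem' := by
    rintro a b ⟨m, hm⟩ ⟨l, hl⟩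
    refine ⟨m + l, ?_⟩
    have := iterate_map_add (D : B →ₗ[k] B) (m + l + 1) a b
    refine this.trans ?_
    have h1 := D.iterate_eq_zero_of_le (show m + 1 ≤ m + l + 1 by omega) hm
    have h2 := D.iterate_eq_zero_of_le (show l + 1 ≤ m + l + 1 by omega) hl
    exact (congrArg₂ (· + ·) h1 h2).trans (add_zero 0)
  algebraMap_mem' r := ⟨0, by simp⟩

theorem Derivation.mem_nilSubalgebra_of_map_mem (D : Derivation k B B) {b : B}
    (h : D b ∈ D.nilSubalgebra) : b ∈ D.nilSubalgebra := by
  obtain ⟨n, hn⟩ := h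
  exact ⟨n + 1, hn⟩

theorem isLND_of_nilSubalgebra_eq_top {D : Derivation k B B} (h : D.nilSubalgebra = ⊤) :
    IsLND D := by
  rw [isLND_iff]
  intro b
  have : b ∈ D.nilSubalgebra := by rw [h]; trivial
  obtain ⟨n, hn⟩ := this
  exact ⟨n + 1, hn⟩

theorem IsLND.exists_iterate_ne_zero {D : Derivation k B B} (hD : IsLND D) {b : B} (hb : b ≠ 0) :
    ∃ n, D^[n] b ≠ 0 ∧ D^[n + 1] b = 0 := by
  classical
  have h := (isLND_iff D).1 hD b
  have h0 : Nat.find h ≠ 0 := fun h0 => hb (by simpa [h0] using Nat.find_spec h)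
  obtain ⟨n, hn⟩ := Nat.exists_eq_succ_of_ne_zero h0
  refine ⟨n, Nat.find_min h (by omega), ?_⟩
  have := Nat.find_spec h
  rwa [hn] at this

/-- The kernel of a locally nilpotent derivation of a domain is factorially closed. -/
theorem IsLND.map_eq_zero_of_mul [CharZero k] [IsDomain B] {D : Derivation k B B} (hD : IsLND D)
    {a b : B} (hab : a * b ≠ 0) (h : D (a * b) = 0) : D a = 0 := by
  have : CharZero B := charZero_of_injective_algebraMap (algebraMap k B).injective
  obtain ⟨m, hm, hm'⟩ := hD.exists_iterate_ne_zero (left_ne_zero_of_mul hab)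
  obtain ⟨l, hl, hl'⟩ := hD.exists_iterate_ne_zero (right_ne_zero_of_mul hab)
  have h1 := D.iterate_add_mul m l hm' hl'
  have h2 : D^[m + l] (a * b) ≠ 0 := by
    rw [h1]
    refine mul_ne_zero ?_ (mul_ne_zero hm hl)
    exact_mod_cast (Nat.choose_pos (Nat.le_add_right m l)).ne'
  rcases m with - | m
  · exact hm'
  · exact absurd (D.iterate_eq_zero_of_le (show 1 ≤ m + 1 + l by omega) h) h2

end Derivation

section Sl2

variable {k B : Type*} [Field k] [CommRing B] [Algebra k B]

/-- Two locally nilpotent derivations and their commutator `E`, satisfying the relations of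
`sl₂`, with `E` diagonalizable with integral weights. -/
structure Sl2Triple (D U E : Derivation k B B) : Prop where
  lnd_left : IsLND D
  lnd_right : IsLND U
  comm : ∀ b, D (U b) = U (D b) + E b
  weight_left : ∀ b, E (D b) = D (E b) + (2 : k) • D b
  weight_right : ∀ b, E (U b) = U (E b) - (2 : k) • U b
  span : ⨆ d : ℤ, Module.End.eigenspace E.toLinearMap (d : k) = ⊤

theorem IsFundamentalPair.sl2Triple {D U : Derivation k B B} (h : IsFundamentalPair D U) :
    Sl2Triple D U ⁅D, U⁆ where
  lnd_left := h.1
  lnd_right := h.2.1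
  comm b := by rw [Derivation.commutator_apply]; ring
  weight_left b := by
    have := DFunLike.congr_fun h.2.2.1 b
    rw [Derivation.commutator_apply] at this
    have h2 : ((-2 : ℤ) • D) b = -((2 : k) • D b) := by
      rw [Derivation.smul_apply, ← Int.cast_smul_eq_zsmul k]
      push_cast
      rw [neg_smul]
    rw [h2] at this
    linear_combination -this
  weight_right b := by
    have := DFunLike.congr_fun h.2.2.2.1 b
    rw [Derivation.commutator_apply] at this
    have h2 : ((2 : ℤ) • U) b = (2 : k) • U b := by
      rw [Derivation.smul_apply, ← Int.cast_smul_eq_zsmul k]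
      push_cast
      rfl
    rw [h2] at this
    linear_combination -this
  span := by
    rw [← h.2.2.2.2]
    congr 1
    ext d b
    simp [gradePiece, sub_eq_zero, Int.cast_smul_eq_zsmul]

namespace Sl2Triple

variable {D U E : Derivation k B B}

theorem symm (T : Sl2Triple D U E) : Sl2Triple U D (-E) where
  lnd_left := T.lnd_right
  lnd_right := T.lnd_left
  comm b := by rw [T.comm]; simp
  weight_left b := by simp [T.weight_right]; abel
  weight_right b := by simp [T.weight_left]; abel
  span := by
    rw [← T.span, ← (Equiv.neg ℤ).iSup_comp]
    congr 1
    ext d b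
    simp [neg_eq_iff_eq_neg]

theorem weight_iterate_left (T : Sl2Triple D U E) {d : k} {b : B} (hb : E b = d • b) (j : ℕ) :
    E (D^[j] b) = (d + 2 * j) • D^[j] b := by
  induction j with
  | zero => simpa using hb
  | succ j ih =>
    rw [Function.iterate_succ_apply', T.weight_left, ih, Derivation.map_smul, ← add_smul]
    congr 1
    push_cast
    ring

theorem weight_iterate_right (T : Sl2Triple D U E) {d : k} {b : B} (hb : E b = d • b) (j : ℕ) :
    E (U^[j] b) = (d - 2 * j) • U^[j] b := by
  induction j with
  | zero => simpa using hb
  | succ j ih =>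
    rw [Function.iterate_succ_apply', T.weight_right, ih, Derivation.map_smul, ← sub_smul]
    congr 1
    push_cast
    ring

theorem map_iterate (T : Sl2Triple D U E) {d : k} {b : B} (hb : E b = d • b)
    (hUD : U (D b) = 0) (j : ℕ) :
    D (U^[j + 1] b) = ((j + 1) * (d - j)) • U^[j] b := by
  induction j with
  | zero => simp [T.comm, hUD, hb]
  | succ j ih =>
    rw [Function.iterate_succ_apply', T.comm, ih, Derivation.map_smul,
      T.weight_iterate_right hb, ← Function.iterate_succ_apply' (f := U), ← add_smul]
    congr 1
    push_cast
    ring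

theorem weight_nonneg [CharZero k] (T : Sl2Triple D U E) {d : k} {b : B} (hb0 : b ≠ 0)
    (hb : E b = d • b) (hUD : U (D b) = 0) : ∃ n : ℕ, d = n ∧ U^[n + 1] b = 0 := by
  obtain ⟨n, hn, hn'⟩ := T.lnd_right.exists_iterate_ne_zero hb0
  have h := T.map_iterate hb hUD n
  rw [hn', map_zero, eq_comm, smul_eq_zero, or_iff_left hn, mul_eq_zero] at h
  refine ⟨n, ?_, hn'⟩
  rcases h with h | h
  · exact absurd h (Nat.cast_add_one_ne_zero n)
  · exact sub_eq_zero.1 h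

theorem iterate_iterate [CharZero k] (T : Sl2Triple D U E) {d : ℕ} {b : B}
    (hb : E b = (d : k) • b) (hD : D b = 0) {j : ℕ} (hj : j ≤ d) :
    ∃ c : k, c ≠ 0 ∧ D^[j] (U^[j] b) = c • b := by
  induction j with
  | zero => exact ⟨1, one_ne_zero, by simp⟩
  | succ j ih =>
    obtain ⟨c, hc, h⟩ := ih (by omega)
    refine ⟨((j + 1) * (d - j)) * c,
      mul_ne_zero (mul_ne_zero (Nat.cast_add_one_ne_zero j) ?_) hc, ?_⟩
    · rw [← Nat.cast_sub (by omega)]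
      exact Nat.cast_ne_zero.2 (by omega)
    · have hs : ∀ (r : k) x, D^[j] (r • x) = r • D^[j] x := fun r x => by
        rw [← Derivation.coeFn_coe, ← Module.End.pow_apply, map_smul,
          Module.End.pow_apply]
      rw [Function.iterate_succ_apply, T.map_iterate hb (by rw [hD, map_zero]), hs, h, smul_smul]

theorem mem_of_weight_nonneg [CharZero k] (T : Sl2Triple D U E) {S : Submodule k B}
    (hU : ∀ b ∈ S, U b ∈ S) (hS : ∀ (d : k) b, D b = 0 → E b = d • b → b ∈ S) (d m : ℕ) {b : B}
    (hb : E b = (d : k) • b) (hm : D^[m] b = 0) : b ∈ S := by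
  have hU' : ∀ j, ∀ b ∈ S, U^[j] b ∈ S := fun j => by
    induction j with
    | zero => exact fun b hb => hb
    | succ j ih => exact fun b hb => ih _ (hU b hb)
  induction m generalizing b with
  | zero =>
    rw [show b = 0 from hm]
    exact S.zero_mem
  | succ m ih =>
    have hw := T.weight_iterate_left hb m
    have hv : D (D^[m] b) = 0 := by rw [← Function.iterate_succ_apply' (f := D), hm]
    obtain ⟨c, hc, h⟩ := T.iterate_iterate (d := d + 2 * m) (b := D^[m] b) (j := m)
      (by rw [hw]; push_cast; rfl) hv (by omega)
    have hvS : U^[m] (D^[m] b) ∈ S := hU' m _ (hS _ _ hv hw)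
    have h1 : c • b - U^[m] (D^[m] b) ∈ S := by
      apply ih
      · rw [map_sub, Derivation.map_smul, hb, T.weight_iterate_right hw, smul_sub, smul_comm]
        congr 2
        ring
      · rw [← Derivation.coeFn_coe, ← Module.End.pow_apply, map_sub, map_smul,
          Module.End.pow_apply, Module.End.pow_apply, Derivation.coeFn_coe, h, sub_self]
    have h2 := S.add_mem h1 hvS
    rw [sub_add_cancel] at h2
    exact (S.smul_mem_iff hc).1 h2

/-- A subspace stable under `sl₂` and containing the highest weight vectors is everything. -/
theorem eq_top [CharZero k] (T : Sl2Triple D U E) {S : Submodule k B}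
    (hDS : ∀ b ∈ S, D b ∈ S) (hUS : ∀ b ∈ S, U b ∈ S)
    (hS : ∀ (d : k) b, D b = 0 → E b = d • b → b ∈ S) : S = ⊤ := by
  rw [eq_top_iff, ← T.span, iSup_le_iff]
  intro d b hb
  rw [Module.End.mem_eigenspace_iff] at hb
  have hb' : E b = (d : k) • b := hb
  obtain ⟨n, rfl | rfl⟩ := d.eq_nat_or_neg
  · obtain ⟨m, hm⟩ := (isLND_iff D).1 T.lnd_left b
    exact T.mem_of_weight_nonneg hUS hS n m (by simpa using hb') hm
  · obtain ⟨m, hm⟩ := (isLND_iff U).1 T.lnd_right b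
    refine T.symm.mem_of_weight_nonneg hDS ?_ n m (by simp [hb']) hm
    intro d u hu hd
    by_cases hu0 : u = 0
    · rw [hu0]; exact S.zero_mem
    obtain ⟨e, rfl, he⟩ := T.symm.weight_nonneg hu0 hd (by rw [hu, map_zero])
    obtain ⟨c, hc, h⟩ := T.symm.iterate_iterate hd hu le_rfl
    rw [← S.smul_mem_iff hc, ← h]
    have hU' : ∀ j, ∀ b ∈ S, U^[j] b ∈ S := fun j => by
      induction j with
      | zero => exact fun b hb => hb
      | succ j ih => exact fun b hb => ih _ (hUS b hb)
    refine hU' e _ (hS (e : k) _ ?_ ?_)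
    · rw [← Function.iterate_succ_apply' (f := D), he]
    · have := T.symm.weight_iterate_right hd e
      rw [Derivation.neg_apply, neg_eq_iff_eq_neg, ← neg_smul] at this
      rw [this]
      congr 1
      ring

end Sl2Triple

end Sl2

section Coordinates

/-- A surjective endomorphism of a noetherian ring is injective. -/
theorem RingHom.injective_of_surjective_endomorphism {R : Type*} [CommRing R] [IsNoetherianRing R]
    (f : R →+* R) (hf : Function.Surjective f) : Function.Injective f := by
  let g : ℕ →o Ideal R :=
    { toFun := fun n => RingHom.ker (f ^ n)
      monotone' := monotone_nat_of_le_succ fun n x hx => by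
        rw [RingHom.mem_ker] at hx ⊢
        rw [pow_succ', RingHom.mul_def, RingHom.comp_apply, hx, map_zero] }
  obtain ⟨n, hn⟩ := monotone_stabilizes_iff_noetherian.2 ‹IsNoetherianRing R› g
  rw [injective_iff_map_eq_zero]
  intro x hx
  obtain ⟨y, rfl⟩ : ∃ y, (f ^ n) y = x := by
    rw [RingHom.coe_pow]
    exact hf.iterate n x
  have hy : y ∈ g (n + 1) := by
    change (f ^ (n + 1)) y = 0
    rw [pow_succ', RingHom.mul_def, RingHom.comp_apply, hx]
  rw [← hn (n + 1) (Nat.le_succ n)] at hy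
  exact hy

variable {k B : Type*} [Field k] [CommRing B] [Algebra k B]

theorem Sl2Triple.map_kernel {D U E : Derivation k B B} (T : Sl2Triple D U E) {b : B}
    (hD : D b = 0) : D (E b) = 0 := by
  have := T.weight_left b
  rwa [hD, map_zero, smul_zero, add_zero, eq_comm] at this

/-- Homogeneous coordinates `w` (of weight zero) and `f` (prime of weight `n`) on `ker D`. -/
structure HomogeneousCoordinates (D E : Derivation k B B) (w f : B) (n : ℕ) : Prop where
  pos : 0 < n
  map_w : D w = 0
  weight_w : E w = 0
  map_f : D f = 0
  weight_f : E f = (n : k) • f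
  prime_f : Prime f
  exists_aeval : ∀ a, D a = 0 → ∃ p : MvPolynomial (Fin 2) k, aeval ![w, f] p = a
  algebraicIndependent : AlgebraicIndependent k ![w, f]

variable [CharZero k]

theorem Sl2Triple.map_eq_zero_iff {D U E : Derivation k B B} (T : Sl2Triple D U E) {b : B}
    (hD : D b = 0) : E b = 0 ↔ U b = 0 := by
  constructor
  · intro hE
    by_cases hb : b = 0
    · rw [hb, map_zero]
    obtain ⟨n, hn, h⟩ := T.weight_nonneg (d := 0) hb (by simpa using hE) (by rw [hD, map_zero])
    obtain rfl : n = 0 := by exact_mod_cast hn.symm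
    exact h
  · intro hU
    have := T.comm b
    rwa [hU, hD, map_zero, map_zero, zero_add, eq_comm] at this

/-- The kernel of `D` is spanned by weight vectors of nonnegative weight. -/
theorem Sl2Triple.kernel_induction {D U E : Derivation k B B} (T : Sl2Triple D U E)
    {p : ↥(kerSubalg D) → Prop} (h0 : p 0) (hadd : ∀ a b, p a → p b → p (a + b))
    (h : ∀ (n : ℕ) (a : ↥(kerSubalg D)), E (a : B) = (n : k) • (a : B) → p a)
    (a : ↥(kerSubalg D)) : p a := by
  obtain ⟨c, hc, hsum⟩ := (Submodule.mem_iSup_iff_exists_finsupp _ (a : B)).1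
    (T.span ▸ Submodule.mem_top)
  have hcE : ∀ d, E (c d) = (d : k) • c d := fun d => Module.End.mem_eigenspace_iff.1 (hc d)
  have hind : iSupIndep fun d : ℤ => Module.End.eigenspace E.toLinearMap ((d : k) + 2) :=
    (Module.End.eigenspaces_iSupIndep E.toLinearMap).comp
      (f := fun d : ℤ => (d : k) + 2) fun x y h => by simpa using h
  have hDc : ∀ d ∈ c.support, D (c d) = 0 := by
    refine (iSupIndep_iff_finsetSum_eq_zero_imp_eq_zero _).1 hind c.support (fun d => D (c d))
      (fun d _ => Module.End.mem_eigenspace_iff.2 ?_) ?_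
    · change E (D (c d)) = _
      rw [T.weight_left, hcE, Derivation.map_smul, ← add_smul]
    · rw [← map_sum]
      exact (congrArg D hsum).trans a.2
  have key : ∀ s ⊆ c.support, ∃ hs : D (∑ d ∈ s, c d) = 0, p ⟨_, hs⟩ := by
    classical
    intro s
    induction s using Finset.induction_on with
    | empty =>
      intro _
      simp only [Finset.sum_empty]
      exact ⟨map_zero D, h0⟩
    | insert d s hd ih =>
      intro hs
      rw [Finset.insert_subset_iff] at hs
      obtain ⟨h1, h2⟩ := ih hs.2
      have hDd := hDc d hs.1
      simp only [Finset.sum_insert hd]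
      refine ⟨by rw [map_add, hDd, h1, add_zero], hadd ⟨c d, hDd⟩ ⟨_, h1⟩ ?_ h2⟩
      obtain ⟨n, hn, -⟩ := T.weight_nonneg (Finsupp.mem_support_iff.1 hs.1) (hcE d)
        (by rw [hDd, map_zero])
      exact h n ⟨c d, hDd⟩ (by rw [hcE d, hn])
  obtain ⟨h1, h2⟩ := key _ subset_rfl
  have : a = ⟨_, h1⟩ := Subtype.ext hsum.symm
  rw [this]
  exact h2

variable [IsDomain B] [UniqueFactorizationMonoid B]

/-- If `ker D` is a polynomial ring in two variables, it has homogeneous coordinates. -/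
theorem Sl2Triple.exists_homogeneousCoordinates {D U E : Derivation k B B} (T : Sl2Triple D U E)
    (e : ↥(kerSubalg D) ≃ₐ[k] MvPolynomial (Fin 2) k)
    (h0 : ∃ a, D a = 0 ∧ E a = 0 ∧ a ∉ Set.range (algebraMap k B))
    (h1 : ∃ a, D a = 0 ∧ E a ≠ 0) :
    ∃ w f n, HomogeneousCoordinates D E w f n := by
  let ε : Derivation k (MvPolynomial (Fin 2) k) (MvPolynomial (Fin 2) k) :=
    Derivation.mk'
      { toFun := fun r => e ⟨E (e.symm r), T.map_kernel (e.symm r).2⟩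
        map_add' := fun r s => by
          rw [← map_add]
          congr 1
          ext
          simp
        map_smul' := fun c r => by
          rw [RingHom.id_apply, ← map_smul]
          congr 1
          ext
          simp }
      (fun r s => by
        simp only [LinearMap.coe_mk, AddHom.coe_mk, smul_eq_mul]
        conv_rhs => rw [← e.apply_symm_apply r, ← e.apply_symm_apply s]
        simp only [e.symm_apply_apply]
        rw [← map_mul, ← map_mul, ← map_add]
        congr 1
        ext
        simp)
  have hε : ∀ a : ↥(kerSubalg D), ε (e a) = e ⟨E a, T.map_kernel a.2⟩ := fun a => by
    change e ⟨E (e.symm (e a)), _⟩ = _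
    congr 2
    rw [e.symm_apply_apply]
  have hεiff : ∀ (a : ↥(kerSubalg D)) (c : k), ε (e a) = c • e a ↔ E (a : B) = c • (a : B) := by
    intro a c
    rw [hε, ← map_smul, e.injective.eq_iff, Subtype.ext_iff]
    rfl
  obtain ⟨φ, hφ1, hφ2, hφ3, hφ4⟩ := ε.exists_coaction (by
    rw [eq_top_iff]
    intro r _
    obtain ⟨a, rfl⟩ := e.surjective r
    refine T.kernel_induction
      (p := fun a => e a ∈ ⨆ d : ℕ, Module.End.eigenspace ε.toLinearMap (d : k)) ?_ ?_ ?_ a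
    · rw [map_zero]; exact zero_mem _
    · intro a b ha hb
      rw [map_add]
      exact add_mem ha hb
    · intro n a ha
      exact Submodule.mem_iSup_of_mem n (Module.End.mem_eigenspace_iff.2 ((hεiff a n).2 ha)))
  have hφε : ∀ {r n}, φ r = Polynomial.monomial n r → ε r = (n : k) • r := fun {r n} h => by
    have := hφ2 r n
    rwa [h, Polynomial.coeff_monomial_same] at this
  obtain ⟨w, f, n, hn, hw, hf, hfp, hsurj⟩ :=
    MvPolynomial.exists_homogeneous_coordinates φ hφ3 hφ4 (by
      obtain ⟨a, hDa, hEa, hak⟩ := h0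
      refine ⟨e ⟨a, hDa⟩, ?_, ?_⟩
      · exact hφ1 _ 0 ((hεiff ⟨a, hDa⟩ _).2 (by simpa using hEa))
      · rintro ⟨c, hc⟩
        apply hak
        refine ⟨c, ?_⟩
        have h2 : e (algebraMap k _ c) = e ⟨a, hDa⟩ := by rw [← hc, e.commutes]; rfl
        exact congrArg Subtype.val (e.injective h2)) (by
      obtain ⟨a, hDa, hEa⟩ := h1
      refine ⟨e ⟨a, hDa⟩, fun h => hEa ?_⟩
      have := (hεiff ⟨a, hDa⟩ _).1 (hφε (n := 0) h)
      simpa using this)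
  obtain ⟨w, rfl⟩ := e.surjective w
  obtain ⟨f, rfl⟩ := e.surjective f
  have hEw := (hεiff w _).1 (hφε (n := 0) hw)
  have hEf := (hεiff f _).1 (hφε hf)
  have hval : ∀ p : MvPolynomial (Fin 2) k,
      aeval ![(w : B), (f : B)] p = ((e.symm (aeval ![e w, e f] p) : ↥(kerSubalg D)) : B) := by
    intro p
    have : (aeval ![(w : B), (f : B)] : MvPolynomial (Fin 2) k →ₐ[k] B) =
        ((kerSubalg D).val.comp e.symm.toAlgHom).comp (aeval ![e w, e f]) := by
      ext i
      fin_cases i <;> simp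
    rw [this]
    rfl
  have hfB : Prime (f : B) := by
    rw [← UniqueFactorizationMonoid.irreducible_iff_prime]
    have hfp' : Irreducible f := by
      have := hfp.irreducible
      rwa [MulEquiv.irreducible_iff e] at this
    have hf0 : (f : B) ≠ 0 := fun h => hfp'.ne_zero (Subtype.ext h)
    constructor
    · rintro hu
      obtain ⟨g, hg⟩ := hu.exists_right_inv
      have hDg : D g = 0 := by
        refine T.lnd_left.map_eq_zero_of_mul (b := f) (by rw [mul_comm, hg]; exact one_ne_zero) ?_
        rw [mul_comm, hg, Derivation.map_one_eq_zero]
      apply hfp'.not_isUnit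
      exact IsUnit.of_mul_eq_one (⟨g, hDg⟩ : ↥(kerSubalg D)) (Subtype.ext hg)
    · intro a b hab
      have hDa : D a = 0 := T.lnd_left.map_eq_zero_of_mul (b := b) (hab ▸ hf0) (hab ▸ f.2)
      have hDb : D b = 0 := T.lnd_left.map_eq_zero_of_mul (b := a)
        (by rw [mul_comm]; exact hab ▸ hf0) (by rw [mul_comm]; exact hab ▸ f.2)
      rcases hfp'.isUnit_or_isUnit (a := ⟨a, hDa⟩) (b := ⟨b, hDb⟩) (Subtype.ext hab) with h | h
      · exact Or.inl (h.map (kerSubalg D).val)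
      · exact Or.inr (h.map (kerSubalg D).val)
  refine ⟨w, f, n, hn, w.2, by simpa using hEw, f.2, hEf, hfB, ?_, ?_⟩
  · intro a ha
    obtain ⟨p, hp⟩ := hsurj (e ⟨a, ha⟩)
    exact ⟨p, by rw [hval, hp, e.symm_apply_apply]⟩
  · have hinj : Function.Injective (aeval ![e w, e f] :
        MvPolynomial (Fin 2) k →ₐ[k] MvPolynomial (Fin 2) k) :=
      RingHom.injective_of_surjective_endomorphism
        (aeval ![e w, e f] : MvPolynomial (Fin 2) k →ₐ[k] MvPolynomial (Fin 2) k).toRingHom hsurj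
    intro p q hpq
    apply hinj
    apply e.symm.injective
    apply Subtype.ext
    rw [← hval, ← hval]
    exact hpq

end Coordinates

section Structure

variable {k B : Type*} [Field k] [CommRing B] [Algebra k B]

theorem Derivation.map_aeval_mvPolynomial {σ : Type*} (D : Derivation k B B) (v : σ → B)
    (d : σ → MvPolynomial σ k) (h : ∀ i, D (v i) = aeval v (d i)) (p : MvPolynomial σ k) :
    D (aeval v p) = aeval v (mkDerivation k d p) := by
  induction p using MvPolynomial.induction_on with
  | C a => simp
  | add p q hp hq => simp only [map_add, hp, hq]
  | mul_X p i hp =>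
    simp only [map_mul, Derivation.leibniz, hp, aeval_X, mkDerivation_X, h, map_add, smul_eq_mul]

/-- An element moved by a derivation of a domain is transcendental over its constants. -/
theorem Derivation.transcendental_of_map_ne_zero [CharZero k] [IsDomain B]
    (D : Derivation k B B) {y : B} (h1 : D y ≠ 0) {S : Subalgebra k B}
    (hS : ∀ a ∈ S, D a = 0) : Transcendental S y := by
  have : CharZero B := charZero_of_injective_algebraMap (algebraMap k B).injective
  have : CharZero S := charZero_of_injective_algebraMap (algebraMap k S).injective
  have hD : ∀ q : Polynomial S, D (Polynomial.aeval y q) =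
      Polynomial.aeval y (Polynomial.derivative q) * D y := fun q => by
    induction q using Polynomial.induction_on' with
    | add p q hp hq => simp only [map_add, hp, hq, add_mul]
    | monomial n a =>
      have ha : D (algebraMap S B a) = 0 := hS a a.2
      simp only [Polynomial.aeval_monomial, Derivation.leibniz, Derivation.leibniz_pow, ha,
        Polynomial.derivative_monomial, map_mul, _root_.map_natCast, smul_eq_mul, nsmul_eq_mul]
      ring
  suffices H : ∀ n, ∀ q : Polynomial S, q.natDegree ≤ n → Polynomial.aeval y q = 0 → q = 0 from
    transcendental_iff.2 fun q hq => H _ q le_rfl hq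
  intro n
  induction n with
  | zero =>
    intro q hq hy
    rw [Polynomial.eq_C_of_natDegree_le_zero hq] at hy ⊢
    rw [Polynomial.aeval_C] at hy
    rw [(FaithfulSMul.algebraMap_injective S B) (hy.trans (map_zero _).symm), map_zero]
  | succ n ih =>
    intro q hq hy
    have hd : Polynomial.derivative q = 0 := by
      refine ih _ ?_ ?_
      · exact (Polynomial.natDegree_derivative_le q).trans (by omega)
      · have := hD q
        rw [hy, map_zero, eq_comm, mul_eq_zero, or_iff_left h1] at this
        exact this
    exact ih q (by rw [Polynomial.derivative_eq_zero.1 hd]; omega) hy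

namespace HomogeneousCoordinates

variable {D U E : Derivation k B B} {w f : B} {n : ℕ}

theorem weight_aeval (H : HomogeneousCoordinates D E w f n) (p : Polynomial k) :
    E (Polynomial.aeval w p) = 0 := by
  rw [Derivation.map_aeval, H.weight_w, smul_zero]

theorem map_aeval (H : HomogeneousCoordinates D E w f n) (p : Polynomial k) :
    D (Polynomial.aeval w p) = 0 := by
  rw [Derivation.map_aeval, H.map_w, smul_zero]

theorem transcendental_w (H : HomogeneousCoordinates D E w f n) : Transcendental k w := by
  simpa using H.algebraicIndependent.transcendental 0

theorem exists_add_mul (H : HomogeneousCoordinates D E w f n) {a : B} (ha : D a = 0) :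
    ∃ (p : Polynomial k) (c : B), D c = 0 ∧ a = Polynomial.aeval w p + f * c := by
  obtain ⟨q, rfl⟩ := H.exists_aeval a ha
  clear ha
  have hD : ∀ q, D (aeval ![w, f] q) = 0 := fun q => by
    rw [D.map_aeval_mvPolynomial ![w, f] 0]
    · rw [show mkDerivation k (0 : Fin 2 → MvPolynomial (Fin 2) k) = 0 from
        derivation_ext (by simp [mkDerivation_X]), Derivation.zero_apply, map_zero]
    · intro i
      fin_cases i <;> simp [H.map_w, H.map_f]
  induction q using MvPolynomial.induction_on with
  | C r => exact ⟨Polynomial.C r, 0, by simp⟩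
  | add q r hq hr =>
    obtain ⟨p, c, hc, h⟩ := hq
    obtain ⟨p', c', hc', h'⟩ := hr
    refine ⟨p + p', c + c', by rw [map_add, hc, hc', add_zero], ?_⟩
    rw [map_add, h, h', map_add]
    ring
  | mul_X q i hq =>
    obtain ⟨p, c, hc, h⟩ := hq
    fin_cases i
    · refine ⟨p * Polynomial.X, c * w, by simp [hc, H.map_w], ?_⟩
      simp [h]
      ring
    · refine ⟨0, aeval ![w, f] q, hD q, ?_⟩
      simp [mul_comm]

theorem map_map_f (H : HomogeneousCoordinates D E w f n) (T : Sl2Triple D U E) :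
    D (U f) = (n : k) • f := by
  rw [T.comm, H.map_f, map_zero, zero_add, H.weight_f]

theorem map_map_map_f (H : HomogeneousCoordinates D E w f n) (T : Sl2Triple D U E) :
    D (U (U f)) = (2 * n - 2 : k) • U f := by
  have := T.map_iterate H.weight_f (by rw [H.map_f, map_zero]) 1
  rw [show U^[1 + 1] f = U (U f) from rfl, show U^[1] f = U f from rfl] at this
  rw [this]
  congr 1
  push_cast
  ring

variable [CharZero k]

theorem map_w_right (H : HomogeneousCoordinates D E w f n) (T : Sl2Triple D U E) : U w = 0 :=
  (T.map_eq_zero_iff H.map_w).1 H.weight_w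

/-- A subalgebra stable under `D` and `U` and containing the coordinates is everything. -/
theorem eq_top_of_mem (H : HomogeneousCoordinates D E w f n) (T : Sl2Triple D U E)
    {S : Subalgebra k B} (hw : w ∈ S) (hf : f ∈ S) (hD : ∀ b ∈ S, D b ∈ S)
    (hU : ∀ b ∈ S, U b ∈ S) : S = ⊤ := by
  have : S.toSubmodule = ⊤ := by
    refine T.eq_top hD hU fun d b hb _ => ?_
    obtain ⟨p, rfl⟩ := H.exists_aeval b hb
    have : (aeval ![w, f] p : B) ∈ Algebra.adjoin k (Set.range ![w, f]) := by
      rw [Algebra.adjoin_range_eq_range_aeval]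
      exact ⟨p, rfl⟩
    refine (Algebra.adjoin_le_iff.2 ?_ : _ ≤ S) this
    rintro _ ⟨i, rfl⟩
    fin_cases i
    · exact hw
    · exact hf
  rwa [Algebra.toSubmodule_eq_top] at this

variable [IsDomain B]

theorem exists_aeval_of_weight_zero (H : HomogeneousCoordinates D E w f n)
    (T : Sl2Triple D U E) {b : B} (hD : D b = 0) (hE : E b = 0) :
    ∃ p : Polynomial k, b = Polynomial.aeval w p := by
  obtain ⟨p, c, hc, rfl⟩ := H.exists_add_mul hD
  rw [map_add, H.weight_aeval, zero_add, Derivation.leibniz, H.weight_f, smul_eq_mul,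
    smul_eq_mul, mul_smul_comm, mul_comm c f, ← mul_smul_comm, ← mul_add, mul_eq_zero,
    or_iff_right H.prime_f.ne_zero] at hE
  by_cases hc0 : c = 0
  · exact ⟨p, by rw [hc0, mul_zero, add_zero]⟩
  obtain ⟨m, hm, -⟩ := T.weight_nonneg (d := -(n : k)) hc0
    (by rw [neg_smul]; exact eq_neg_of_add_eq_zero_left hE) (by rw [hc, map_zero])
  have h : ((m + n : ℕ) : k) = 0 := by push_cast; rw [← hm]; ring
  have := H.pos
  rw [Nat.cast_eq_zero] at h
  omega

theorem not_dvd_map (H : HomogeneousCoordinates D E w f n) (T : Sl2Triple D U E) :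
    ¬f ∣ U f := by
  rintro ⟨h, hh⟩
  have hDU : D (U f) = (n : k) • f := by rw [T.comm, H.map_f, map_zero, zero_add, H.weight_f]
  have hn : (n : k) ≠ 0 := Nat.cast_ne_zero.2 H.pos.ne'
  have hDh : D h = algebraMap k B n := by
    rw [hh, Derivation.leibniz, H.map_f, smul_zero, add_zero, smul_eq_mul, Algebra.smul_def,
      mul_comm _ f] at hDU
    exact mul_left_cancel₀ H.prime_f.ne_zero hDU
  have hEh : E h = (-2 : k) • h := by
    have := T.weight_right f
    rw [H.weight_f, Derivation.map_smul, hh, Derivation.leibniz, H.weight_f] at this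
    apply mul_left_cancel₀ H.prime_f.ne_zero
    simp only [Algebra.smul_def, map_neg, map_ofNat] at this ⊢
    linear_combination this
  have h0 : h ≠ 0 := by
    rintro rfl
    rw [map_zero, eq_comm, map_eq_zero] at hDh
    exact hn hDh
  obtain ⟨m, hm, -⟩ := T.weight_nonneg h0 hEh (by rw [hDh, Derivation.map_algebraMap])
  have : ((m + 2 : ℕ) : k) = 0 := by push_cast; rw [← hm]; ring
  rw [Nat.cast_eq_zero] at this
  omega

theorem map_f_ne_zero (H : HomogeneousCoordinates D E w f n) (T : Sl2Triple D U E) : U f ≠ 0 :=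
  fun h => H.not_dvd_map T (h ▸ dvd_zero f)

theorem weight_eq (H : HomogeneousCoordinates D E w f n) (T : Sl2Triple D U E) :
    n = 1 ∨ n = 2 := by
  by_contra! hn
  have hn1 : (n : k) - 1 ≠ 0 := sub_ne_zero.2 (by exact_mod_cast hn.1)
  have hn2 : 2 * (n : k) - 4 ≠ 0 := by
    rw [show 2 * (n : k) - 4 = 2 * ((n : k) - 2) by ring]
    exact mul_ne_zero two_ne_zero (sub_ne_zero.2 (by exact_mod_cast hn.2))
  set h : B := (n : k) • (f * U (U f)) - ((n : k) - 1) • (U f) ^ 2 with hh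
  have h1 := H.map_map_f T
  have h2 := H.map_map_map_f T
  have w1 := T.weight_iterate_right H.weight_f 1
  have w2 := T.weight_iterate_right H.weight_f 2
  rw [show U^[1] f = U f from rfl] at w1
  rw [show U^[2] f = U (U f) from rfl] at w2
  have hD : D h = 0 := by
    rw [hh, map_sub, Derivation.map_smul, Derivation.map_smul]
    simp only [Derivation.leibniz, Derivation.leibniz_pow, h1, h2, H.map_f, smul_eq_mul,
      Algebra.smul_def, map_sub, map_mul, map_one, map_ofNat]
    push_cast
    ring
  have hE : E h = (2 * n - 4 : k) • h := by
    rw [hh, map_sub, Derivation.map_smul, Derivation.map_smul]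
    simp only [Derivation.leibniz, Derivation.leibniz_pow, w1, w2, H.weight_f, smul_eq_mul,
      Algebra.smul_def, map_sub, map_mul, map_one,
      map_ofNat, map_natCast]
    push_cast
    ring
  have hfh : f ∣ h := by
    obtain ⟨p, c, hc, hpc⟩ := H.exists_add_mul hD
    have hp : f ∣ (2 * n - 4 : k) • Polynomial.aeval w p := by
      refine ⟨(n : k) • c + E c - (2 * n - 4 : k) • c, ?_⟩
      rw [hpc, map_add, H.weight_aeval, Derivation.leibniz, H.weight_f] at hE
      simp only [Algebra.smul_def] at hE ⊢
      linear_combination -hE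
    rw [Algebra.smul_def] at hp
    have hu : IsUnit (algebraMap k B (2 * n - 4)) := (IsUnit.mk0 _ hn2).map _
    rw [hu.dvd_mul_left] at hp
    by_cases hp0 : Polynomial.aeval w p = 0
    · rw [hpc, hp0, zero_add]
      exact dvd_mul_right f c
    · obtain ⟨q, hq⟩ := hp
      refine absurd (T.lnd_right.map_eq_zero_of_mul (a := f) (b := q) (hq ▸ hp0) ?_)
        (H.map_f_ne_zero T)
      rw [← hq]
      exact (T.map_eq_zero_iff (H.map_aeval p)).1 (H.weight_aeval p)
  apply H.not_dvd_map T
  apply H.prime_f.dvd_of_dvd_pow (n := 2)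
  have hu : IsUnit (algebraMap k B ((n : k) - 1)) := (IsUnit.mk0 _ hn1).map _
  rw [← hu.dvd_mul_left, ← Algebra.smul_def]
  have : ((n : k) - 1) • (U f) ^ 2 = (n : k) • (f * U (U f)) - h := by rw [hh]; ring
  rw [this]
  exact dvd_sub (dvd_smul_of_dvd _ (dvd_mul_right f _)) hfh

theorem algebraicIndependent_cons (H : HomogeneousCoordinates D E w f n) {y : B} (hy : D y = f) :
    AlgebraicIndependent k ![w, f, y] := by
  have ht : Transcendental (Algebra.adjoin k (Set.range ![w, f])) y := by
    refine D.transcendental_of_map_ne_zero (hy ▸ H.prime_f.ne_zero) ?_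
    have : Algebra.adjoin k (Set.range ![w, f]) ≤ kerSubalg D := by
      rw [Algebra.adjoin_le_iff]
      rintro _ ⟨i, rfl⟩
      fin_cases i
      · exact H.map_w
      · exact H.map_f
    exact this
  have h := (H.algebraicIndependent.option_iff_transcendental y).2 ht
  have h2 := h.comp (![some 0, some 1, none] : Fin 3 → Option (Fin 2)) (by decide)
  convert h2 using 1
  ext i
  fin_cases i <;> rfl

/-- If some locally nilpotent derivation moves `w`, then the Makar-Limanov invariant is `k`. -/
theorem makarLimanov_eq (H : HomogeneousCoordinates D E w f n) (T : Sl2Triple D U E)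
    {δ : Derivation k B B} (hδ : IsLND δ) (hδw : δ w ≠ 0) :
    {b : B | ∀ δ : Derivation k B B, IsLND δ → δ b = 0} = Set.range (algebraMap k B) := by
  ext b
  constructor
  · intro hb
    have hDb := hb D T.lnd_left
    obtain ⟨p, rfl⟩ := H.exists_aeval_of_weight_zero T hDb
      ((T.map_eq_zero_iff hDb).2 (hb U T.lnd_right))
    have h := hb δ hδ
    rw [Derivation.map_aeval, smul_eq_mul, mul_eq_zero, or_iff_left hδw] at h
    have hp := transcendental_iff.1 H.transcendental_w _ h
    refine ⟨p.coeff 0, ?_⟩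
    conv_rhs => rw [Polynomial.eq_C_of_natDegree_eq_zero
      (Polynomial.derivative_eq_zero.1 hp), Polynomial.aeval_C]
  · rintro ⟨c, rfl⟩ δ -
    exact δ.map_algebraMap c

end HomogeneousCoordinates

end Structure

section Models

variable {k B : Type*} [Field k] [CommRing B] [Algebra k B]

theorem Derivation.nilSubalgebra_eq_top_of_surjective {σ : Type*} (δ : Derivation k B B) {v : σ → B}
    (hv : Function.Surjective (aeval v : MvPolynomial σ k →ₐ[k] B))
    (h : ∀ i, v i ∈ δ.nilSubalgebra) : δ.nilSubalgebra = ⊤ := by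
  rw [eq_top_iff, ← (AlgHom.range_eq_top _).2 hv, ← Algebra.adjoin_range_eq_range_aeval,
    Algebra.adjoin_le_iff]
  rintro _ ⟨i, rfl⟩
  exact h i

/-- Modulo `2XZ − Y² − P(W)` and up to powers of `X`, the variable `Z` can be eliminated. -/
theorem exists_pow_mul_sub_rename_mem_qIdeal [CharZero k] (P : Polynomial k)
    (p : MvPolynomial (Fin 4) k) :
    ∃ (N : ℕ) (q : MvPolynomial (Fin 3) k), X 0 ^ N * p - rename ![3, 0, 1] q ∈ qIdeal k P := by
  simp only [← Ideal.Quotient.mk_eq_mk_iff_sub_mem]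
  set π := Ideal.Quotient.mk (qIdeal k P)
  have hrel : π (X 0 * X 2) = π (C (1 / 2) * (X 1 ^ 2 + Polynomial.aeval (X 3) P)) := by
    rw [Ideal.Quotient.mk_eq_mk_iff_sub_mem]
    refine Ideal.mem_span_singleton.2 ⟨C (1 / 2), ?_⟩
    have : (C (1 / 2) * 2 : MvPolynomial (Fin 4) k) = 1 := by
      rw [show (2 : MvPolynomial (Fin 4) k) = C 2 from (map_ofNat C 2).symm, ← C_mul]
      simp
    linear_combination -(X 0 * X 2) * this
  induction p using MvPolynomial.induction_on with
  | C a => exact ⟨0, C a, by simp⟩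
  | add p₁ p₂ h₁ h₂ =>
    obtain ⟨N₁, q₁, h₁⟩ := h₁
    obtain ⟨N₂, q₂, h₂⟩ := h₂
    refine ⟨N₁ + N₂, X 1 ^ N₂ * q₁ + X 1 ^ N₁ * q₂, ?_⟩
    simp only [map_add, map_mul, map_pow, rename_X, ← h₁, ← h₂, Matrix.cons_val_one,
      Matrix.cons_val_zero]
    ring
  | mul_X p i h =>
    obtain ⟨N, q, h⟩ := h
    fin_cases i
    · refine ⟨N, q * X 1, ?_⟩
      simp [← h, mul_assoc]
    · refine ⟨N, q * X 2, ?_⟩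
      simp [← h, mul_assoc]
    · refine ⟨N + 1, q * (C (1 / 2) * (X 2 ^ 2 + Polynomial.aeval (X 0) P)), ?_⟩
      rw [map_mul (rename _), map_mul π (rename _ q), ← h]
      have : rename ![3, 0, 1] (C (1 / 2) * (X 2 ^ 2 + Polynomial.aeval (X 0) P)) =
          (C (1 / 2) * (X 1 ^ 2 + Polynomial.aeval (X 3) P) : MvPolynomial (Fin 4) k) := by
        simp [← Polynomial.aeval_algHom_apply]
      rw [this, ← hrel, ← map_mul]
      congr 1
      simp only [Fin.reduceFinMk]
      ring
    · refine ⟨N, q * X 0, ?_⟩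
      simp [← h, mul_assoc]

theorem MvPolynomial.not_X_dvd_quadric (P : Polynomial k) :
    ¬(X 0 : MvPolynomial (Fin 4) k) ∣ 2 * X 0 * X 2 - X 1 ^ 2 - Polynomial.aeval (X 3) P := by
  rintro ⟨c, hc⟩
  have h0 := congrArg (aeval ![(0 : k), 0, 0, 0]) hc
  have h1 := congrArg (aeval ![(0 : k), 1, 0, 0]) hc
  simp only [map_sub, map_mul, map_pow, ← Polynomial.aeval_algHom_apply, aeval_X] at h0 h1
  simp at h0 h1
  simp [h0] at h1

/-- The algebra of polynomial relations of a point of the quadric bundle `2XZ − Y² = P(W)`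
whose coordinates `X`, `Y`, `W` are algebraically independent. -/
theorem ker_aeval_eq_qIdeal [CharZero k] [IsDomain B] {x y z w : B} {P : Polynomial k}
    (hrel : 2 * x * z - y ^ 2 = Polynomial.aeval w P)
    (hind : AlgebraicIndependent k ![w, x, y]) :
    RingHom.ker (aeval ![x, y, z, w] : MvPolynomial (Fin 4) k →ₐ[k] B) = qIdeal k P := by
  have hle : qIdeal k P ≤ RingHom.ker (aeval ![x, y, z, w] : MvPolynomial (Fin 4) k →ₐ[k] B) := by
    rw [Ideal.span_singleton_le_iff_mem, RingHom.mem_ker]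
    simp [← Polynomial.aeval_algHom_apply, ← hrel]
  refine le_antisymm (fun p hp => ?_) hle
  obtain ⟨N, q, hq⟩ := exists_pow_mul_sub_rename_mem_qIdeal P p
  have h := hle hq
  rw [RingHom.mem_ker] at hp h
  rw [map_sub, map_mul, hp, mul_zero, zero_sub, neg_eq_zero, aeval_rename] at h
  have hv : (![x, y, z, w] : Fin 4 → B) ∘ ![3, 0, 1] = ![w, x, y] := by
    ext i
    fin_cases i <;> rfl
  rw [hv] at h
  rw [hind (h.trans (map_zero _).symm), map_zero, sub_zero, Ideal.mem_span_singleton] at hq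
  obtain ⟨c, hc⟩ := hq
  have hX : Prime (X 0 : MvPolynomial (Fin 4) k) := X_prime
  obtain ⟨d, rfl⟩ := hX.pow_dvd_of_dvd_mul_left N (MvPolynomial.not_X_dvd_quadric P)
    (hc ▸ dvd_mul_right (X 0 ^ N) p)
  refine Ideal.mem_span_singleton.2 ⟨d, ?_⟩
  apply mul_left_cancel₀ (pow_ne_zero N hX.ne_zero)
  rw [hc]
  ring

namespace HomogeneousCoordinates

variable {D U E : Derivation k B B} {w f : B} [CharZero k]

theorem surjective_aeval {n : ℕ} (H : HomogeneousCoordinates D E w f n) (T : Sl2Triple D U E)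
    {σ : Type*} {v : σ → B} (hw : w ∈ Set.range v) (hf : f ∈ Set.range v)
    {dD dU : σ → MvPolynomial σ k} (hD : ∀ i, D (v i) = aeval v (dD i))
    (hU : ∀ i, U (v i) = aeval v (dU i)) :
    Function.Surjective (aeval v : MvPolynomial σ k →ₐ[k] B) := by
  rw [← AlgHom.range_eq_top]
  have hv : ∀ i, v i ∈ (aeval v : MvPolynomial σ k →ₐ[k] B).range := fun i => ⟨X i, by simp⟩
  refine H.eq_top_of_mem T ?_ ?_ ?_ ?_
  · obtain ⟨i, rfl⟩ := hw
    exact hv i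
  · obtain ⟨i, rfl⟩ := hf
    exact hv i
  · rintro _ ⟨p, rfl⟩
    exact ⟨mkDerivation k dD p, (D.map_aeval_mvPolynomial v dD hD p).symm⟩
  · rintro _ ⟨p, rfl⟩
    exact ⟨mkDerivation k dU p, (U.map_aeval_mvPolynomial v dU hU p).symm⟩

variable [IsDomain B]

theorem exists_algEquiv_mvPolynomial (H : HomogeneousCoordinates D E w f 1)
    (T : Sl2Triple D U E) :
    (∃ α : B ≃ₐ[k] MvPolynomial (Fin 3) k,
        (∀ b : B, α (D b) = mkDerivation k ![0, 0, X 1] (α b)) ∧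
        (∀ b : B, α (U b) = mkDerivation k ![0, X 2, 0] (α b))) ∧
      ∃ δ : Derivation k B B, IsLND δ ∧ δ w ≠ 0 := by
  have hDg : D (U f) = f := by simpa using H.map_map_f T
  have hUg : U (U f) = 0 := by
    obtain ⟨n, hn, h⟩ := T.weight_nonneg H.prime_f.ne_zero H.weight_f (by rw [H.map_f, map_zero])
    rw [Nat.cast_inj] at hn
    rwa [← hn] at h
  set v : Fin 3 → B := ![w, f, U f] with hv
  have hD : ∀ i, D (v i) = aeval v ((![0, 0, X 1] : Fin 3 → MvPolynomial (Fin 3) k) i) := by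
    intro i
    fin_cases i <;> simp [hv, H.map_w, H.map_f, hDg]
  have hU : ∀ i, U (v i) = aeval v ((![0, X 2, 0] : Fin 3 → MvPolynomial (Fin 3) k) i) := by
    intro i
    fin_cases i <;> simp [hv, H.map_w_right T, hUg]
  have hsurj := H.surjective_aeval T ⟨0, rfl⟩ ⟨1, rfl⟩ hD hU
  have hinj : Function.Injective (aeval v : MvPolynomial (Fin 3) k →ₐ[k] B) :=
    H.algebraicIndependent_cons hDg
  let β : MvPolynomial (Fin 3) k ≃ₐ[k] B := AlgEquiv.ofBijective (aeval v) ⟨hinj, hsurj⟩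
  have hβ : ∀ p, β p = aeval v p := fun p => rfl
  refine ⟨⟨β.symm, fun b => ?_, fun b => ?_⟩, ?_⟩
  · obtain ⟨p, rfl⟩ := β.surjective b
    rw [AlgEquiv.symm_apply_apply, AlgEquiv.symm_apply_eq, hβ, hβ, D.map_aeval_mvPolynomial v _ hD]
  · obtain ⟨p, rfl⟩ := β.surjective b
    rw [AlgEquiv.symm_apply_apply, AlgEquiv.symm_apply_eq, hβ, hβ, U.map_aeval_mvPolynomial v _ hU]
  · have hd : ∀ p : MvPolynomial (Fin 3) k, aeval v p = 0 → aeval v (pderiv 0 p) = 0 := by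
      intro p hp
      rw [hinj (hp.trans (map_zero _).symm), map_zero, map_zero]
    let δ := Derivation.liftOfSurjective (f := (aeval v : MvPolynomial (Fin 3) k →ₐ[k] B)) hsurj hd
    have hδ : ∀ i, δ (v i) = aeval v (pderiv 0 (X i : MvPolynomial (Fin 3) k)) := fun i => by
      rw [← Derivation.liftOfSurjective_apply hsurj hd, aeval_X]
    have hδ0 : δ w = 1 := by simpa [hv] using hδ 0
    refine ⟨δ, isLND_of_nilSubalgebra_eq_top (δ.nilSubalgebra_eq_top_of_surjective hsurj ?_),
      by rw [hδ0]; exact one_ne_zero⟩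
    intro i
    apply δ.mem_nilSubalgebra_of_map_mem
    rw [hδ, pderiv_X]
    obtain rfl | hi := eq_or_ne i 0
    · simp [one_mem]
    · simp [Pi.single_eq_of_ne hi, zero_mem]

theorem exists_algEquiv_quotient (H : HomogeneousCoordinates D E w f 2)
    (T : Sl2Triple D U E) :
    (∃ (P : Polynomial k) (α : B ≃ₐ[k] (MvPolynomial (Fin 4) k ⧸ qIdeal k P)),
        ∀ p : MvPolynomial (Fin 4) k,
          D (α.symm (Ideal.Quotient.mk (qIdeal k P) p)) =
            α.symm (Ideal.Quotient.mk (qIdeal k P) (mkDerivation k ![0, X 0, X 1, 0] p)) ∧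
          U (α.symm (Ideal.Quotient.mk (qIdeal k P) p)) =
            α.symm (Ideal.Quotient.mk (qIdeal k P)
              (mkDerivation k ![2 * X 1, 2 * X 2, 0, 0] p))) ∧
      ∃ δ : Derivation k B B, IsLND δ ∧ δ w ≠ 0 := by
  have hU3 : U (U (U f)) = 0 := by
    obtain ⟨n, hn, h⟩ := T.weight_nonneg H.prime_f.ne_zero H.weight_f (by rw [H.map_f, map_zero])
    rw [Nat.cast_inj] at hn
    rwa [← hn] at h
  obtain ⟨y, hy⟩ : ∃ y, y = (1 / 2 : k) • U f := ⟨_, rfl⟩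
  obtain ⟨z, hz⟩ : ∃ z, z = (1 / 4 : k) • U (U f) := ⟨_, rfl⟩
  have hDy : D y = f := by
    rw [hy, Derivation.map_smul, H.map_map_f T, smul_smul]
    norm_num
  have hDz : D z = y := by
    rw [hz, hy, Derivation.map_smul, H.map_map_map_f T, smul_smul]
    norm_num
  have hUf : U f = 2 * y := by
    rw [hy, two_mul, ← add_smul]
    norm_num
  have hUy : U y = 2 * z := by
    rw [hy, hz, Derivation.map_smul, two_mul, ← add_smul]
    norm_num
  have hUz : U z = 0 := by rw [hz, Derivation.map_smul, hU3, smul_zero]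
  obtain ⟨P, hP⟩ : ∃ P : Polynomial k, 2 * f * z - y ^ 2 = Polynomial.aeval w P := by
    have h2 : D (2 * f * z - y ^ 2) = 0 := by
      rw [mul_assoc, two_mul]
      simp [Derivation.leibniz, Derivation.leibniz_pow, H.map_f, hDy, hDz]
      ring
    refine H.exists_aeval_of_weight_zero T h2 ((T.map_eq_zero_iff h2).2 ?_)
    rw [mul_assoc, two_mul]
    simp [Derivation.leibniz, Derivation.leibniz_pow, hUf, hUy, hUz]
    ring
  set v : Fin 4 → B := ![f, y, z, w] with hv
  have hD : ∀ i, D (v i) = aeval v ((![0, X 0, X 1, 0] : Fin 4 → MvPolynomial (Fin 4) k) i) := by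
    intro i
    fin_cases i <;> simp [hv, H.map_w, H.map_f, hDy, hDz]
  have hU : ∀ i, U (v i) =
      aeval v ((![2 * X 1, 2 * X 2, 0, 0] : Fin 4 → MvPolynomial (Fin 4) k) i) := by
    intro i
    fin_cases i <;> simp [hv, H.map_w_right T, hUf, hUy, hUz]
  have hsurj := H.surjective_aeval T ⟨3, rfl⟩ ⟨0, rfl⟩ hD hU
  have hker := ker_aeval_eq_qIdeal hP (H.algebraicIndependent_cons hDy)
  let β : (MvPolynomial (Fin 4) k ⧸ qIdeal k P) ≃ₐ[k] B :=
    (Ideal.quotientEquivAlgOfEq k hker.symm).trans (Ideal.quotientKerAlgEquivOfSurjective hsurj)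
  have hβ : ∀ p, β (Ideal.Quotient.mk (qIdeal k P) p) = aeval v p := fun p => rfl
  refine ⟨⟨P, β.symm, fun p => ?_⟩, ?_⟩
  · rw [AlgEquiv.symm_symm, hβ, hβ, hβ]
    exact ⟨D.map_aeval_mvPolynomial v _ hD p, U.map_aeval_mvPolynomial v _ hU p⟩
  · let d : Derivation k (MvPolynomial (Fin 4) k) (MvPolynomial (Fin 4) k) :=
      mkDerivation k ![0, 0, Polynomial.aeval (X 3) (Polynomial.derivative P), 2 * X 0]
    have hd : ∀ p : MvPolynomial (Fin 4) k, aeval v p = 0 → aeval v (d p) = 0 := fun p hp => by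
      rw [← RingHom.mem_ker, hker, Ideal.mem_span_singleton] at hp
      obtain ⟨c, rfl⟩ := hp
      have h0 : d (2 * X 0 * X 2 - X 1 ^ 2 - Polynomial.aeval (X 3) P) = 0 := by
        rw [mul_assoc, two_mul]
        simp [d, Derivation.leibniz, Derivation.leibniz_pow, mkDerivation_X, Derivation.map_aeval]
        ring
      rw [Derivation.leibniz, h0, smul_zero, add_zero, smul_eq_mul, map_mul]
      have : (2 * X 0 * X 2 - X 1 ^ 2 - Polynomial.aeval (X 3) P : MvPolynomial (Fin 4) k) ∈
          RingHom.ker (aeval v : MvPolynomial (Fin 4) k →ₐ[k] B) := by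
        rw [hker]
        exact Ideal.mem_span_singleton_self _
      rw [RingHom.mem_ker.1 this, zero_mul]
    let δ := Derivation.liftOfSurjective (f := (aeval v : MvPolynomial (Fin 4) k →ₐ[k] B)) hsurj hd
    have hδ : ∀ i, δ (v i) = aeval v (d (X i)) := fun i => by
      rw [← Derivation.liftOfSurjective_apply hsurj hd, aeval_X]
    have hδx : δ f = 0 := by simpa [hv, d, mkDerivation_X] using hδ 0
    have hδy : δ y = 0 := by simpa [hv, d, mkDerivation_X] using hδ 1
    have hδw : δ w = 2 * f := by simpa [hv, d, mkDerivation_X] using hδ 3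
    have hδz : δ z = Polynomial.aeval w (Polynomial.derivative P) := by
      simpa [hv, d, mkDerivation_X, ← Polynomial.aeval_algHom_apply] using hδ 2
    have : CharZero B := charZero_of_injective_algebraMap (algebraMap k B).injective
    refine ⟨δ, isLND_of_nilSubalgebra_eq_top (δ.nilSubalgebra_eq_top_of_surjective hsurj ?_),
      by rw [hδw]; exact mul_ne_zero two_ne_zero H.prime_f.ne_zero⟩
    have hx : f ∈ δ.nilSubalgebra :=
      δ.mem_nilSubalgebra_of_map_mem (by rw [hδx]; exact zero_mem _)
    have hw : w ∈ δ.nilSubalgebra :=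
      δ.mem_nilSubalgebra_of_map_mem (by rw [hδw]; exact mul_mem (ofNat_mem _ 2) hx)
    intro i
    fin_cases i
    · exact hx
    · exact δ.mem_nilSubalgebra_of_map_mem (by change δ y ∈ _; rw [hδy]; exact zero_mem _)
    · refine δ.mem_nilSubalgebra_of_map_mem ?_
      change δ z ∈ _
      rw [hδz]
      exact (Algebra.adjoin_le (Set.singleton_subset_iff.2 hw) : _ ≤ δ.nilSubalgebra)
        (Polynomial.aeval_mem_adjoin_singleton k w)
    · exact hw

end HomogeneousCoordinates

end Models

section Main

variable {k B : Type*} [Field k] [CharZero k] [CommRing B] [Algebra k B]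

theorem Sl2Triple.exists_weight_ne_zero {D U E : Derivation k B B} (T : Sl2Triple D U E)
    (h : ¬(D = 0 ∧ U = 0)) : ∃ a, D a = 0 ∧ E a ≠ 0 := by
  by_contra! hE
  have hU : ∀ a, D a = 0 → U a = 0 := fun a ha => (T.map_eq_zero_iff ha).1 (hE a ha)
  have htop : (kerSubalg D).toSubmodule = ⊤ := by
    refine T.eq_top (fun b hb => ?_) (fun b hb => ?_) fun d b hb _ => hb
    · rw [show D b = 0 from hb]
      exact Submodule.zero_mem _
    · rw [hU b hb]
      exact Submodule.zero_mem _
  have hD : ∀ b, D b = 0 := fun b => by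
    have : b ∈ (kerSubalg D).toSubmodule := htop ▸ Submodule.mem_top
    exact this
  exact h ⟨Derivation.ext hD, Derivation.ext fun b => hU b (hD b)⟩

end Main

/-- let `B` be an affine UFD over `k` with a nontrivial fundamental pair
`(D,U)` such that `A_0 ≠ k` and `A = ker D ≅ k^[2]`.  Then either `B ≅ k[X,Y,Z]` with
`(D,U)` corresponding to `(Y∂_Z, Z∂_Y)`, or `B ≅ k[X,Y,Z,W]/(2XZ − Y² − P(W))` for some
`P ∈ k[T]` with `(D,U)` induced by `(X∂_Y + Y∂_Z, 2Y∂_X + 2Z∂_Y)`; in both cases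
`ML(B) = k`. -/
theorem stmt_17 {k B : Type*} [Field k] [CharZero k] [CommRing B] [IsDomain B]
    [UniqueFactorizationMonoid B] [Algebra k B] [Algebra.FiniteType k B]
    (D U : Derivation k B B) (hDU : IsFundamentalPair D U) (hnt : ¬(D = 0 ∧ U = 0))
    (hA0 : ∃ a : B, D a = 0 ∧ U a = 0 ∧ a ∉ Set.range (algebraMap k B))
    (hA : Nonempty (↥(kerSubalg D) ≃ₐ[k] MvPolynomial (Fin 2) k)) :
    ((∃ α : B ≃ₐ[k] MvPolynomial (Fin 3) k,
        (∀ b : B, α (D b) = mkDerivation k ![0, 0, X 1] (α b)) ∧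
        (∀ b : B, α (U b) = mkDerivation k ![0, X 2, 0] (α b))) ∨
     (∃ (P : Polynomial k) (α : B ≃ₐ[k] (MvPolynomial (Fin 4) k ⧸ qIdeal k P)),
        ∀ p : MvPolynomial (Fin 4) k,
          D (α.symm (Ideal.Quotient.mk (qIdeal k P) p)) =
            α.symm (Ideal.Quotient.mk (qIdeal k P)
              (mkDerivation k ![0, X 0, X 1, 0] p)) ∧
          U (α.symm (Ideal.Quotient.mk (qIdeal k P) p)) =
            α.symm (Ideal.Quotient.mk (qIdeal k P)
              (mkDerivation k ![2 * X 1, 2 * X 2, 0, 0] p)))) ∧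
    {b : B | ∀ δ : Derivation k B B, IsLND δ → δ b = 0} = Set.range (algebraMap k B) := by
  have T := hDU.sl2Triple
  obtain ⟨e⟩ := hA
  obtain ⟨w, f, n, H⟩ := T.exists_homogeneousCoordinates e
    (by
      obtain ⟨a, hDa, hUa, ha⟩ := hA0
      exact ⟨a, hDa, (T.map_eq_zero_iff hDa).2 hUa, ha⟩)
    (T.exists_weight_ne_zero hnt)
  obtain rfl | rfl := H.weight_eq T
  · obtain ⟨h, δ, hδ, hδw⟩ := H.exists_algEquiv_mvPolynomial T
    exact ⟨Or.inl h, H.makarLimanov_eq T hδ hδw⟩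
  · obtain ⟨h, δ, hδ, hδw⟩ := H.exists_algEquiv_quotient T
    exact ⟨Or.inr h, H.makarLimanov_eq T hδ hδw⟩
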